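/- arXiv:2504.13485 — 2 statements merged into one kernel-verified Lean document; each statement's English description precedes it below -/
import Mathlib

section
/- If ξ₁, ξ₂ ∈ ℝ^d satisfy ‖ξ₁‖ < 1, ‖ξ₂‖ < 1, ξ₁ ≠ ξ₂ and g(ξ₁) = g(ξ₂), then σ(ξ₂) is the image of σ(ξ₁) under the orthogonal reflection across the hyperplane orthogonal to a, i.e. σ(ξ₂) = σ(ξ₁) − 2 (⟨σ(ξ₁), a⟩ / ‖a‖²) a. -/
open Matrix

noncomputable section

/-- `f ξ = √(1 - ‖ξ‖²)` (Euclidean norm, written via the dot product). -/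
def fH {d : ℕ} (ξ : Fin d → ℝ) : ℝ := Real.sqrt (1 - ξ ⬝ᵥ ξ)

/-- `σ ξ = (f ξ, ξ) ∈ ℝ^{1+d}`. -/
def sigmaH {d : ℕ} (ξ : Fin d → ℝ) : Fin (d + 1) → ℝ := Fin.cons (fH ξ) ξ

/-- `π (x₀, x) = x`. -/
def piH {d : ℕ} (z : Fin (d + 1) → ℝ) : Fin d → ℝ := fun i => z i.succ

/-- `e₀ = (1, 0, …, 0)`. -/
def e0H {d : ℕ} : Fin (d + 1) → ℝ := fun i => if i = 0 then 1 else 0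

/-- the lower-right `d × d` block of `G`. -/
def G0H {d : ℕ} (G : Matrix (Fin (d + 1)) (Fin (d + 1)) ℝ) : Matrix (Fin d) (Fin d) ℝ :=
  fun i j => G i.succ j.succ

/-- `b = π (Gᵀ e₀)`. -/
def bH {d : ℕ} (G : Matrix (Fin (d + 1)) (Fin (d + 1)) ℝ) : Fin d → ℝ :=
  piH (Gᵀ.mulVec e0H)

/-- `g ξ = π (Gᵀ σ(ξ))`. -/
def gH {d : ℕ} (G : Matrix (Fin (d + 1)) (Fin (d + 1)) ℝ) (ξ : Fin d → ℝ) : Fin d → ℝ :=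
  piH (Gᵀ.mulVec (sigmaH ξ))

/-- `a = (Gᵀ)⁻¹ e₀`. -/
def aH {d : ℕ} (G : Matrix (Fin (d + 1)) (Fin (d + 1)) ℝ) : Fin (d + 1) → ℝ :=
  (Gᵀ)⁻¹.mulVec e0H

/-- The matrix of the linear map `M(ξ) : v ↦ G₀ᵀ v - (⟨ξ, v⟩ / f ξ) • b`. -/
def MH {d : ℕ} (G : Matrix (Fin (d + 1)) (Fin (d + 1)) ℝ) (ξ : Fin d → ℝ) :
    Matrix (Fin d) (Fin d) ℝ :=
  (G0H G)ᵀ - (fH ξ)⁻¹ • vecMulVec (bH G) ξ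

theorem sigmaH_dotProduct_self {d : ℕ} {ξ : Fin d → ℝ} (h : ξ ⬝ᵥ ξ ≤ 1) :
    sigmaH ξ ⬝ᵥ sigmaH ξ = 1 := by
  have hs : fH ξ * fH ξ = 1 - ξ ⬝ᵥ ξ := Real.mul_self_sqrt (by linarith)
  have hcons : sigmaH ξ ⬝ᵥ sigmaH ξ = fH ξ * fH ξ + ξ ⬝ᵥ ξ := by
    simp [dotProduct, Fin.sum_univ_succ, sigmaH]
  linarith

theorem sigmaH_injective {d : ℕ} : Function.Injective (sigmaH (d := d)) :=
  fun _ _ h => (Fin.cons_injective2 h).2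

theorem eq_smul_e0H_of_piH_eq_zero {d : ℕ} {z : Fin (d + 1) → ℝ} (h : piH z = 0) :
    z = z 0 • e0H := by
  funext i
  refine Fin.cases ?_ (fun j => ?_) i
  · simp [e0H]
  · simpa [e0H, piH] using congrFun h j

/-- A vector whose image under `Gᵀ` is killed by `π` is a multiple of `a`. -/
theorem exists_eq_smul_aH {d : ℕ} {G : Matrix (Fin (d + 1)) (Fin (d + 1)) ℝ}
    (hG : IsUnit G.det) {v : Fin (d + 1) → ℝ} (h : piH (Gᵀ.mulVec v) = 0) :
    ∃ t : ℝ, v = t • aH G := by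
  refine ⟨Gᵀ.mulVec v 0, ?_⟩
  have hdet : IsUnit Gᵀ.det := by rwa [det_transpose]
  rw [aH, ← mulVec_smul, ← eq_smul_e0H_of_piH_eq_zero h, mulVec_mulVec,
    nonsing_inv_mul _ hdet, one_mulVec]

/-- Two distinct vectors of equal length that differ by a multiple of `a` are
reflections of each other across the hyperplane orthogonal to `a`. -/
theorem eq_reflection_of_dotProduct_self_eq {n : Type*} [Fintype n] {u v a : n → ℝ} {t : ℝ}
    (hne : u ≠ v) (hlen : u ⬝ᵥ u = v ⬝ᵥ v) (h : v - u = t • a) :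
    v = u - (2 * (u ⬝ᵥ a) / (a ⬝ᵥ a)) • a := by
  have hta : t • a ≠ 0 := h ▸ sub_ne_zero.2 hne.symm
  obtain ⟨ht, ha⟩ := smul_ne_zero_iff.1 hta
  have haa : a ⬝ᵥ a ≠ 0 := fun h0 => ha (dotProduct_self_eq_zero.1 h0)
  obtain rfl : v = u + t • a := by rw [← h]; abel
  have hmul : t * (t * (a ⬝ᵥ a) + 2 * (u ⬝ᵥ a)) = 0 := by
    simp only [add_dotProduct, dotProduct_add, smul_dotProduct, dotProduct_smul, smul_eq_mul,
      dotProduct_comm a u] at hlen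
    linarith
  have hlin := (mul_eq_zero.1 hmul).resolve_left ht
  have hquot : t = -(2 * (u ⬝ᵥ a) / (a ⬝ᵥ a)) := by
    field_simp
    linarith
  rw [sub_eq_add_neg, ← neg_smul, ← hquot]

/-- If `ξ₁ ≠ ξ₂` have the same image under `g`, then `σ(ξ₂)` is the reflection of
`σ(ξ₁)` across the hyperplane orthogonal to `a`. -/
theorem stmt_6 (d : ℕ) (hd : 1 ≤ d) (G : Matrix (Fin (d + 1)) (Fin (d + 1)) ℝ)
    (hG : IsUnit G.det) (ξ₁ ξ₂ : Fin d → ℝ) (h₁ : ξ₁ ⬝ᵥ ξ₁ < 1) (h₂ : ξ₂ ⬝ᵥ ξ₂ < 1)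
    (hne : ξ₁ ≠ ξ₂) (heq : gH G ξ₁ = gH G ξ₂) :
    sigmaH ξ₂ = sigmaH ξ₁ - (2 * (sigmaH ξ₁ ⬝ᵥ aH G) / (aH G ⬝ᵥ aH G)) • aH G := by
  have hpi : piH (Gᵀ.mulVec (sigmaH ξ₂ - sigmaH ξ₁)) = 0 := by
    rw [mulVec_sub]
    funext i
    exact sub_eq_zero.2 (congrFun heq i).symm
  obtain ⟨t, ht⟩ := exists_eq_smul_aH hG hpi
  exact eq_reflection_of_dotProduct_self_eq (sigmaH_injective.ne hne)
    ((sigmaH_dotProduct_self h₁.le).trans (sigmaH_dotProduct_self h₂.le).symm) ht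

end
end

section
/- For every (x, ξ) ∈ ℝ^d × ℝ^d with ‖ξ‖ < 1 and ⟨σ(ξ), a⟩ ≠ 0 (so that M(ξ) is invertible), the map κ_{U_G} : (x, ξ) ↦ ((M(ξ)ᵀ)⁻¹ x, g(ξ)) is differentiable at (x, ξ) and its derivative L preserves the standard symplectic form: ω(L(u, v), L(u', v')) = ω((u, v), (u', v')) for all (u, v), (u', v') ∈ ℝ^d × ℝ^d. -/
open Matrix

noncomputable section

/-- `κ_{U_G} (x, ξ) = ((M(ξ)ᵀ)⁻¹ x, g(ξ))`. -/
def kappaG {d : ℕ} (G : Matrix (Fin (d + 1)) (Fin (d + 1)) ℝ)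
    (p : (Fin d → ℝ) × (Fin d → ℝ)) : (Fin d → ℝ) × (Fin d → ℝ) :=
  (((MH G p.2)ᵀ)⁻¹.mulVec p.1, gH G p.2)

theorem HasFDerivAt.dotProduct {E ι : Type*} [NormedAddCommGroup E] [NormedSpace ℝ E] [Fintype ι]
    {u v : E → ι → ℝ} {u' v' : E →L[ℝ] (ι → ℝ)} {z : E}
    (hu : HasFDerivAt u u' z) (hv : HasFDerivAt v v' z) :
    HasFDerivAt (fun y => u y ⬝ᵥ v y)
      (∑ i, (u z i • (ContinuousLinearMap.proj i).comp v' +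
        v z i • (ContinuousLinearMap.proj i).comp u')) z :=
  HasFDerivAt.fun_sum fun i _ => (hasFDerivAt_pi'.1 hu i).mul (hasFDerivAt_pi'.1 hv i)

theorem differentiableAt_det {E n : Type*} [NormedAddCommGroup E] [NormedSpace ℝ E]
    [Fintype n] [DecidableEq n] {A : E → Matrix n n ℝ} {z : E}
    (hA : ∀ i j, DifferentiableAt ℝ (fun y => A y i j) z) :
    DifferentiableAt ℝ (fun y => (A y).det) z := by
  simp only [Matrix.det_apply']
  fun_prop

theorem differentiableAt_matrix_inv_apply {E n : Type*} [NormedAddCommGroup E] [NormedSpace ℝ E]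
    [Fintype n] [DecidableEq n] {A : E → Matrix n n ℝ} {z : E}
    (hA : ∀ i j, DifferentiableAt ℝ (fun y => A y i j) z) (hz : (A z).det ≠ 0) (i j : n) :
    DifferentiableAt ℝ (fun y => (A y)⁻¹ i j) z := by
  simp only [Matrix.inv_def, Ring.inverse_eq_inv', Matrix.smul_apply, smul_eq_mul,
    Matrix.adjugate_apply]
  refine ((differentiableAt_det hA).fun_inv hz).mul (differentiableAt_det fun k l => ?_)
  by_cases hk : k = j
  · subst hk
    simp
  · simpa [Matrix.updateRow_ne hk] using hA k l

theorem fH_pos {d : ℕ} {ξ : Fin d → ℝ} (hξ : ξ ⬝ᵥ ξ < 1) : 0 < fH ξ :=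
  Real.sqrt_pos.2 (by linarith)

theorem exists_hasFDerivAt_fH {d : ℕ} {ξ : Fin d → ℝ} (hξ : ξ ⬝ᵥ ξ < 1) :
    ∃ f' : (Fin d → ℝ) →L[ℝ] ℝ, HasFDerivAt fH f' ξ ∧ ∀ v, f' v = -((fH ξ)⁻¹ * (ξ ⬝ᵥ v)) := by
  have h1 := ((hasFDerivAt_id (𝕜 := ℝ) ξ).dotProduct (hasFDerivAt_id ξ)).const_sub 1
  refine ⟨_, h1.sqrt (by simpa using (sub_pos.2 hξ).ne'), fun v => ?_⟩
  have : √(1 - ξ ⬝ᵥ ξ) ≠ 0 := (fH_pos hξ).ne'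
  simp [fH, Finset.sum_add_distrib, dotProduct]
  ring

theorem gH_eq {d : ℕ} (G : Matrix (Fin (d + 1)) (Fin (d + 1)) ℝ) (ξ : Fin d → ℝ) :
    gH G ξ = fH ξ • bH G + (G0H G)ᵀ *ᵥ ξ := by
  ext i
  simp [gH, piH, bH, e0H, sigmaH, G0H, mulVec, dotProduct, Fin.sum_univ_succ, mul_comm]

theorem MH_mulVec {d : ℕ} (G : Matrix (Fin (d + 1)) (Fin (d + 1)) ℝ) (ξ v : Fin d → ℝ) :
    MH G ξ *ᵥ v = (G0H G)ᵀ *ᵥ v - ((fH ξ)⁻¹ * (ξ ⬝ᵥ v)) • bH G := by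
  simp [MH, sub_mulVec, smul_mulVec, vecMulVec_mulVec, smul_smul]

theorem MH_transpose_mulVec {d : ℕ} (G : Matrix (Fin (d + 1)) (Fin (d + 1)) ℝ)
    (ξ z : Fin d → ℝ) :
    (MH G ξ)ᵀ *ᵥ z = G0H G *ᵥ z - ((fH ξ)⁻¹ * (bH G ⬝ᵥ z)) • ξ := by
  simp [MH, sub_mulVec, smul_mulVec, transpose_vecMulVec, vecMulVec_mulVec, smul_smul]

theorem MH_det_ne_zero {d : ℕ} {G : Matrix (Fin (d + 1)) (Fin (d + 1)) ℝ}
    (hG : IsUnit G.det) {ξ : Fin d → ℝ} (hξ : ξ ⬝ᵥ ξ < 1) (ha : sigmaH ξ ⬝ᵥ aH G ≠ 0) :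
    (MH G ξ).det ≠ 0 := by
  intro h0
  obtain ⟨v, hv, hMv⟩ := exists_mulVec_eq_zero_iff.2 h0
  have hf : fH ξ ≠ 0 := (fH_pos hξ).ne'
  set w : Fin (d + 1) → ℝ := Fin.cons (-((fH ξ)⁻¹ * (ξ ⬝ᵥ v))) v with hw
  have hσw : sigmaH ξ ⬝ᵥ w = 0 := by
    rw [dotProduct, Fin.sum_univ_succ]
    simp only [sigmaH, hw, Fin.cons_zero, Fin.cons_succ]
    rw [mul_neg, mul_inv_cancel_left₀ hf]
    exact neg_add_cancel _
  have hGw : Gᵀ *ᵥ w = (Gᵀ *ᵥ w) 0 • e0H := by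
    ext i
    refine Fin.cases (by simp [e0H]) (fun j => ?_) i
    have := congrFun hMv j
    rw [MH_mulVec] at this
    simp [bH, piH, e0H, G0H, mulVec, dotProduct, hw, Fin.sum_univ_succ] at this ⊢
    linarith
  have hwa : w = (Gᵀ *ᵥ w) 0 • aH G := by
    rw [aH, ← mulVec_smul, ← hGw, mulVec_mulVec, nonsing_inv_mul _ (by simpa using hG),
      one_mulVec]
  have hc : (Gᵀ *ᵥ w) 0 = 0 := by
    rw [hwa, dotProduct_smul, smul_eq_mul] at hσw
    exact (mul_eq_zero.1 hσw).resolve_right ha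
  rw [hc, zero_smul] at hwa
  exact hv (funext fun i => by simpa [hw] using congrFun hwa i.succ)

theorem hasFDerivAt_gH {d : ℕ} (G : Matrix (Fin (d + 1)) (Fin (d + 1)) ℝ) {ξ : Fin d → ℝ}
    (hξ : ξ ⬝ᵥ ξ < 1) :
    HasFDerivAt (gH G) (MH G ξ).mulVecLin.toContinuousLinearMap ξ := by
  obtain ⟨f', hf', hf'v⟩ := exists_hasFDerivAt_fH hξ
  have h := (hf'.smul_const (bH G)).add
    ((G0H G)ᵀ.mulVecLin.toContinuousLinearMap.hasFDerivAt (x := ξ))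
  have hL : LinearMap.toContinuousLinearMap (MH G ξ).mulVecLin =
      f'.smulRight (bH G) + LinearMap.toContinuousLinearMap (G0H G)ᵀ.mulVecLin := by
    ext1 v
    simp [MH_mulVec, hf'v, sub_eq_neg_add, mulVec_transpose]
  rw [hL]
  exact h.congr_of_eventuallyEq (.of_forall fun η => gH_eq G η)

theorem differentiableAt_MH_apply {d : ℕ} (G : Matrix (Fin (d + 1)) (Fin (d + 1)) ℝ)
    (x : Fin d → ℝ) {ξ : Fin d → ℝ} (hξ : ξ ⬝ᵥ ξ < 1) (i j : Fin d) :
    DifferentiableAt ℝ (fun p : (Fin d → ℝ) × (Fin d → ℝ) => MH G p.2 i j) (x, ξ) := by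
  obtain ⟨f', hf', -⟩ := exists_hasFDerivAt_fH hξ
  have hf : DifferentiableAt ℝ (fun p : (Fin d → ℝ) × (Fin d → ℝ) => fH p.2) (x, ξ) :=
    DifferentiableAt.comp (x, ξ) (f := Prod.snd) (g := fH)
      hf'.differentiableAt differentiableAt_snd
  have hfi := hf.fun_inv (fH_pos hξ).ne'
  simp only [MH, Matrix.sub_apply, Matrix.smul_apply, vecMulVec_apply, smul_eq_mul]
  fun_prop

theorem differentiableAt_kappaG_fst {d : ℕ} {G : Matrix (Fin (d + 1)) (Fin (d + 1)) ℝ}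
    {x ξ : Fin d → ℝ} (hξ : ξ ⬝ᵥ ξ < 1) (hdet : (MH G ξ).det ≠ 0) :
    DifferentiableAt ℝ (fun p => (kappaG G p).1) (x, ξ) := by
  refine differentiableAt_pi.2 fun i => ?_
  simp only [kappaG, mulVec, dotProduct]
  refine DifferentiableAt.fun_sum fun j _ => DifferentiableAt.mul ?_ (by fun_prop)
  exact differentiableAt_matrix_inv_apply
    (A := fun p : (Fin d → ℝ) × (Fin d → ℝ) => (MH G p.2)ᵀ)
    (fun k l => differentiableAt_MH_apply G x hξ l k)
    (by simpa using hdet) i j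

theorem MH_transpose_mulVec_fderiv_kappaG_fst {d : ℕ}
    {G : Matrix (Fin (d + 1)) (Fin (d + 1)) ℝ} {x ξ : Fin d → ℝ} (hξ : ξ ⬝ᵥ ξ < 1)
    (hdet : (MH G ξ).det ≠ 0) {A' : (Fin d → ℝ) × (Fin d → ℝ) →L[ℝ] (Fin d → ℝ)}
    (hA : HasFDerivAt (fun p => (kappaG G p).1) A' (x, ξ)) (q : (Fin d → ℝ) × (Fin d → ℝ)) :
    (MH G ξ)ᵀ *ᵥ A' q = q.1 + (bH G ⬝ᵥ (kappaG G (x, ξ)).1) •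
      ((fH ξ)⁻¹ • q.2 + ((fH ξ)⁻¹ ^ 3 * (ξ ⬝ᵥ q.2)) • ξ) := by
  obtain ⟨f', hf', hf'v⟩ := exists_hasFDerivAt_fH hξ
  have hf : HasFDerivAt (fun p : (Fin d → ℝ) × (Fin d → ℝ) => fH p.2)
      (f'.comp (ContinuousLinearMap.snd ℝ _ _)) (x, ξ) :=
    HasFDerivAt.comp (x, ξ) (f := Prod.snd) (g := fH) hf' hasFDerivAt_snd
  have hfi := (hasDerivAt_inv (fH_pos hξ).ne').comp_hasFDerivAt (x, ξ) hf
  have hb := (hasFDerivAt_const (𝕜 := ℝ) (bH G) (x, ξ)).dotProduct hA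
  have hF := ((G0H G).mulVecLin.toContinuousLinearMap.hasFDerivAt.comp (x, ξ) hA).sub
    ((hfi.mul hb).smul (hasFDerivAt_snd (𝕜 := ℝ) (p := (x, ξ))))
  have hdiff : DifferentiableAt ℝ (fun p : (Fin d → ℝ) × (Fin d → ℝ) => (MH G p.2).det) (x, ξ) :=
    differentiableAt_det (differentiableAt_MH_apply G x hξ)
  have hev := (hdiff.continuousAt.eventually_ne hdet).mono fun p hp =>
    show (MH G p.2)ᵀ *ᵥ (kappaG G p).1 = p.1 by
      rw [kappaG, mulVec_mulVec, mul_nonsing_inv _ (by simpa using hp), one_mulVec]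
  have hfst : HasFDerivAt (fun p : (Fin d → ℝ) × (Fin d → ℝ) => (MH G p.2)ᵀ *ᵥ (kappaG G p).1)
      (ContinuousLinearMap.fst ℝ _ _) (x, ξ) := hasFDerivAt_fst.congr_of_eventuallyEq hev
  simp only [MH_transpose_mulVec] at hfst
  have h := DFunLike.congr_fun (hF.unique hfst) q
  rw [MH_transpose_mulVec]
  simp [hf'v] at h
  ext i
  have h := congrFun h i
  simp [dotProduct] at h ⊢
  rw [← h]
  ring

/-- Where `⟨σ(ξ), a⟩ ≠ 0` (so that `M(ξ)` is invertible), `κ_{U_G}` is differentiable and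
its derivative preserves the standard symplectic form
`ω((u,v),(u',v')) = ⟨v,u'⟩ − ⟨u,v'⟩`. -/
theorem stmt_12 (d : ℕ) (hd : 1 ≤ d) (G : Matrix (Fin (d + 1)) (Fin (d + 1)) ℝ)
    (hG : IsUnit G.det) (x ξ : Fin d → ℝ) (hξ : ξ ⬝ᵥ ξ < 1)
    (ha : sigmaH ξ ⬝ᵥ aH G ≠ 0) :
    ∃ L : ((Fin d → ℝ) × (Fin d → ℝ)) →L[ℝ] ((Fin d → ℝ) × (Fin d → ℝ)),
      HasFDerivAt (kappaG G) L (x, ξ) ∧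
      ∀ p q : (Fin d → ℝ) × (Fin d → ℝ),
        (L p).2 ⬝ᵥ (L q).1 - (L p).1 ⬝ᵥ (L q).2 = p.2 ⬝ᵥ q.1 - p.1 ⬝ᵥ q.2 := by
  have hdet := MH_det_ne_zero hG hξ ha
  have hA := (differentiableAt_kappaG_fst (x := x) hξ hdet).hasFDerivAt
  have hg : HasFDerivAt (fun p : (Fin d → ℝ) × (Fin d → ℝ) => gH G p.2) _ (x, ξ) :=
    HasFDerivAt.comp (x, ξ) (f := Prod.snd) (g := gH G) (hasFDerivAt_gH G hξ) hasFDerivAt_snd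
  refine ⟨_, hA.prodMk hg, fun p q => ?_⟩
  have key (v z : Fin d → ℝ) : MH G ξ *ᵥ v ⬝ᵥ z = v ⬝ᵥ (MH G ξ)ᵀ *ᵥ z := by
    rw [mulVec_transpose, dotProduct_comm v, ← dotProduct_mulVec, dotProduct_comm]
  simp only [ContinuousLinearMap.prod_apply, ContinuousLinearMap.comp_apply,
    ContinuousLinearMap.coe_snd', LinearMap.coe_toContinuousLinearMap', mulVecLin_apply]
  rw [dotProduct_comm _ (MH G ξ *ᵥ q.2), key, key,
    MH_transpose_mulVec_fderiv_kappaG_fst hξ hdet hA,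
    MH_transpose_mulVec_fderiv_kappaG_fst hξ hdet hA]
  simp only [dotProduct_add, dotProduct_smul, smul_eq_mul]
  rw [dotProduct_comm q.2 p.1, dotProduct_comm q.2 p.2, dotProduct_comm q.2 ξ,
    dotProduct_comm p.2 ξ]
  ring

end
end
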